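/- arXiv:0705.1739 — 3 statements merged into one kernel-verified Lean document; each statement's English description precedes it below -/
import Mathlib

section
/- Let H be a real number ≥ 1, let p, q be integers with q > 0 and set m = p/q. Let c₁, c₂, c₃ be integers with c₁ ≠ 0, c₃ ≥ 0, and such that either one of c₁, c₂ equals 1 and the other equals 0, or c₁ and c₂ are both nonzero and coprime. If there exist at least three distinct integer points (x, y) with |x| ≤ H and |y| ≤ H satisfying (c₁x − c₂)² + (c₁y − m·c₂)² = c₃, then |c₁| ≤ 4q(1+|m|)H, |c₂| ≤ 2qH², and c₃ ≤ 36q²(1+|m|)²H⁴. -/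
/-- Two proportional integer vectors, the first of which is primitive. -/
lemma exists_mul_eq_of_isCoprime {a b A B : ℤ} (hab : IsCoprime a b) (h : a * B = b * A) :
    ∃ k : ℤ, A = k * a ∧ B = k * b := by
  obtain ⟨u, v, huv⟩ := hab
  exact ⟨u * A + v * B, by linear_combination (-A) * huv - v * h,
    by linear_combination (-B) * huv + u * h⟩

/-- A line `x + m y = const` meets a circle centred at the origin in at most two points. -/
lemma false_of_three_points_on_line_and_circle {m x₁ y₁ x₂ y₂ x₃ y₃ : ℝ}
    (h₁₂ : ¬(x₁ = x₂ ∧ y₁ = y₂)) (h₁₃ : ¬(x₁ = x₃ ∧ y₁ = y₃)) (h₂₃ : ¬(x₂ = x₃ ∧ y₂ = y₃))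
    (hL₂ : x₁ + m * y₁ = x₂ + m * y₂) (hL₃ : x₁ + m * y₁ = x₃ + m * y₃)
    (hN₂ : x₁ ^ 2 + y₁ ^ 2 = x₂ ^ 2 + y₂ ^ 2) (hN₃ : x₁ ^ 2 + y₁ ^ 2 = x₃ ^ 2 + y₃ ^ 2) :
    False := by
  obtain rfl : x₂ = x₁ + m * y₁ - m * y₂ := by linarith
  obtain rfl : x₃ = x₁ + m * y₁ - m * y₃ := by linarith
  have h12 : y₁ - y₂ ≠ 0 := fun h => h₁₂ ⟨by linear_combination (-m) * h, by linarith⟩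
  have h13 : y₁ - y₃ ≠ 0 := fun h => h₁₃ ⟨by linear_combination (-m) * h, by linarith⟩
  have h23 : y₂ - y₃ ≠ 0 := fun h => h₂₃ ⟨by linear_combination (-m) * h, by linarith⟩
  have e₂ : (1 + m ^ 2) * (y₁ + y₂) - 2 * m * (x₁ + m * y₁) = 0 :=
    mul_left_cancel₀ h12 (by linear_combination hN₂)
  have e₃ : (1 + m ^ 2) * (y₁ + y₃) - 2 * m * (x₁ + m * y₁) = 0 :=
    mul_left_cancel₀ h13 (by linear_combination hN₃)
  have hm : 1 + m ^ 2 ≠ 0 := by positivity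
  exact h23 (mul_left_cancel₀ hm (by linear_combination e₂ - e₃))

lemma sq_add_sq_mul_sq_add_sq_le {K x y : ℝ} (hx : 0 ≤ x) (hxK : x ≤ K) (hy : 0 ≤ y)
    (hyK : y ≤ K) : (x ^ 2 + y ^ 2) * ((K - y) ^ 2 + x ^ 2) ≤ 2 * K ^ 4 := by
  have hx2 : x ^ 2 ≤ K ^ 2 := by gcongr
  have hu : 0 ≤ y * (K - y) := mul_nonneg hy (by linarith)
  have hu' : y * (K - y) ≤ 2 * K ^ 2 := by nlinarith
  calc (x ^ 2 + y ^ 2) * ((K - y) ^ 2 + x ^ 2)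
      ≤ (K ^ 2 + y ^ 2) * ((K - y) ^ 2 + K ^ 2) := by gcongr
    _ = 2 * K ^ 4 - y * (K - y) * (2 * K ^ 2 - y * (K - y)) := by ring
    _ ≤ 2 * K ^ 4 := sub_le_self _ (mul_nonneg hu (by linarith))

lemma norm_sq_mul_cross_sq_add_inner_sq_le {K m a₁ a₂ d₁ d₂ : ℝ} (h₁ : |a₁| + |d₁| ≤ K)
    (h₂ : |a₂| + |d₂| ≤ K) :
    (d₁ ^ 2 + d₂ ^ 2) * ((m * a₁ - a₂) ^ 2 + (d₁ + m * d₂) ^ 2) ≤ 2 * (1 + |m|) ^ 2 * K ^ 4 := by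
  have hcross : (m * a₁ - a₂) ^ 2 ≤ (|m| * (K - |d₁|) + (K - |d₂|)) ^ 2 := by
    refine sq_le_sq' ?_ ?_ <;>
    · have h := mul_le_mul_of_nonneg_left (show |a₁| ≤ K - |d₁| by linarith) (abs_nonneg m)
      rw [← abs_mul] at h
      linarith [neg_abs_le (m * a₁), le_abs_self (m * a₁), neg_abs_le a₂, le_abs_self a₂]
  have hinner : (d₁ + m * d₂) ^ 2 ≤ (|d₁| + |m| * |d₂|) ^ 2 := by
    rw [← abs_mul, ← sq_abs]
    gcongr
    exact abs_add_le _ _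
  rw [← sq_abs d₁, ← sq_abs d₂]
  have hx := abs_nonneg d₁
  have hy := abs_nonneg d₂
  have ht := abs_nonneg m
  have hxK : |d₁| ≤ K := by linarith [abs_nonneg a₁]
  have hyK : |d₂| ≤ K := by linarith [abs_nonneg a₂]
  generalize |d₁| = x at *
  generalize |d₂| = y at *
  generalize |m| = t at *
  have g₁ := sq_add_sq_mul_sq_add_sq_le hx hxK hy hyK
  have g₂ := sq_add_sq_mul_sq_add_sq_le hy hyK hx hxK
  have hcs : 0 ≤ (x ^ 2 + y ^ 2) * (((K - y) - (K - x)) ^ 2 + (x - y) ^ 2) := by positivity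
  calc (x ^ 2 + y ^ 2) * ((m * a₁ - a₂) ^ 2 + (d₁ + m * d₂) ^ 2)
      ≤ (x ^ 2 + y ^ 2) * ((t * (K - x) + (K - y)) ^ 2 + (x + t * y) ^ 2) := by gcongr
    _ ≤ (1 + t) * ((x ^ 2 + y ^ 2) * ((K - y) ^ 2 + x ^ 2))
        + t * (1 + t) * ((y ^ 2 + x ^ 2) * ((K - x) ^ 2 + y ^ 2)) := by
      linear_combination t * hcs
    _ ≤ (1 + t) * (2 * K ^ 4) + t * (1 + t) * (2 * K ^ 4) := by gcongr
    _ = 2 * (1 + t) ^ 2 * K ^ 4 := by ring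

lemma abs_add_add_abs_sub_le {H x y : ℝ} (hx : |x| ≤ H) (hy : |y| ≤ H) :
    |x + y| + |x - y| ≤ 2 * H := by
  rw [abs_le] at hx hy
  rcases abs_cases (x + y) with h | h <;> rcases abs_cases (x - y) with h' | h' <;> linarith

/-- The height bounds, given two integer points with distinct values of `x + m y`. -/
lemma circle_bounds_of_two_points {H m : ℝ} {p q c₁ c₂ c₃ : ℤ} (hq : 0 < q)
    (hm : m = (p : ℝ) / q) (hc₁ : c₁ ≠ 0) (hcop : IsCoprime c₁ c₂) {P Q : ℤ × ℤ}
    (hP : |(P.1 : ℝ)| ≤ H ∧ |(P.2 : ℝ)| ≤ H ∧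
      ((c₁ : ℝ) * P.1 - c₂) ^ 2 + ((c₁ : ℝ) * P.2 - m * c₂) ^ 2 = c₃)
    (hQ : |(Q.1 : ℝ)| ≤ H ∧ |(Q.2 : ℝ)| ≤ H ∧
      ((c₁ : ℝ) * Q.1 - c₂) ^ 2 + ((c₁ : ℝ) * Q.2 - m * c₂) ^ 2 = c₃)
    (hL : (P.1 : ℝ) + m * P.2 ≠ Q.1 + m * Q.2) :
    |(c₁ : ℝ)| ≤ 4 * q * (1 + |m|) * H ∧ |(c₂ : ℝ)| ≤ 2 * q * H ^ 2 ∧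
      (c₃ : ℝ) ≤ 36 * q ^ 2 * (1 + |m|) ^ 2 * H ^ 4 := by
  obtain ⟨x, y⟩ := P
  obtain ⟨z, w⟩ := Q
  obtain ⟨hx, hy, eP⟩ := hP
  obtain ⟨hz, hw, eQ⟩ := hQ
  dsimp only at *
  have hq' : (0 : ℝ) < q := by exact_mod_cast hq
  have hqm : (q : ℝ) * m = p := by rw [hm]; field_simp
  have hint : c₁ * (q * (x ^ 2 + y ^ 2 - z ^ 2 - w ^ 2))
      = c₂ * (2 * (q * (x - z) + p * (y - w))) := by
    have h : (c₁ : ℝ) * (c₁ * (q * (x ^ 2 + y ^ 2 - z ^ 2 - w ^ 2))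
        - c₂ * (2 * (q * (x - z) + p * (y - w)))) = 0 := by
      rw [← hqm]
      linear_combination (q : ℝ) * (eP - eQ)
    have h' := (mul_eq_zero.mp h).resolve_left (by exact_mod_cast hc₁)
    exact_mod_cast sub_eq_zero.mp h'
  obtain ⟨k, hA, hB⟩ := exists_mul_eq_of_isCoprime hcop hint
  have hA' : 2 * q * ((x - z) + m * (y - w)) = (k : ℝ) * c₁ := by
    have : (2 * (q * (x - z) + p * (y - w)) : ℝ) = k * c₁ := by exact_mod_cast hA
    linear_combination this + 2 * (y - w) * hqm
  have hB' : (q : ℝ) * (x ^ 2 + y ^ 2 - z ^ 2 - w ^ 2) = k * c₂ := by exact_mod_cast hB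
  have hk : k ≠ 0 := by
    rintro rfl
    have h0 : 2 * (q : ℝ) * ((x - z) + m * (y - w)) = 0 := by rw [hA']; simp
    rcases mul_eq_zero.mp h0 with h | h
    · linarith
    · exact hL (by linarith)
  have hk1 : (1 : ℝ) ≤ |(k : ℝ)| := by exact_mod_cast Int.one_le_abs hk
  have hle : ∀ c : ℝ, |c| ≤ |k * c| := fun c => by
    rw [abs_mul]
    exact le_mul_of_one_le_left (abs_nonneg c) hk1
  have hX := abs_add_add_abs_sub_le hx hz
  have hY := abs_add_add_abs_sub_le hy hw
  refine ⟨(hle _).trans ?_, (hle _).trans ?_, ?_⟩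
  · rw [← hA', abs_mul, abs_of_pos (by positivity)]
    have h1 : |(x : ℝ) - z| ≤ 2 * H := by linarith [abs_nonneg ((x : ℝ) + z)]
    have h2 : |(y : ℝ) - w| ≤ 2 * H := by linarith [abs_nonneg ((y : ℝ) + w)]
    calc 2 * (q : ℝ) * |(x - z) + m * (y - w)|
        ≤ 2 * q * (|(x : ℝ) - z| + |m| * |(y : ℝ) - w|) := by
          rw [← abs_mul]
          gcongr
          exact abs_add_le _ _
      _ ≤ 2 * q * (2 * H + |m| * (2 * H)) := by gcongr
      _ = 4 * q * (1 + |m|) * H := by ring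
  · rw [← hB', abs_mul, abs_of_pos hq', mul_comm 2 (q : ℝ), mul_assoc]
    gcongr
    have sx := sq_le_sq.mpr (hx.trans (le_abs_self H))
    have sy := sq_le_sq.mpr (hy.trans (le_abs_self H))
    have sz := sq_le_sq.mpr (hz.trans (le_abs_self H))
    have sw := sq_le_sq.mpr (hw.trans (le_abs_self H))
    rw [abs_le]
    constructor <;> nlinarith
  · have hc₃ : (0 : ℝ) ≤ c₃ := by rw [← eP]; positivity
    have hk2 : (1 : ℝ) ≤ (k : ℝ) ^ 2 := by rw [← sq_abs]; exact one_le_pow₀ hk1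
    have key := norm_sq_mul_cross_sq_add_inner_sq_le (m := m) hX hY
    calc (c₃ : ℝ) ≤ (k : ℝ) ^ 2 * c₃ := le_mul_of_one_le_left hc₃ hk2
      _ = (k * c₁ * x - k * c₂) ^ 2 + (k * c₁ * y - m * (k * c₂)) ^ 2 := by
        rw [← eP]; ring
      _ = (q : ℝ) ^ 2 * ((((x : ℝ) - z) ^ 2 + (y - w) ^ 2)
          * ((m * (x + z) - (y + w)) ^ 2 + ((x - z) + m * (y - w)) ^ 2)) := by
        rw [← hA', ← hB']; ring
      _ ≤ (q : ℝ) ^ 2 * (2 * (1 + |m|) ^ 2 * (2 * H) ^ 4) := by gcongr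
      _ ≤ 36 * q ^ 2 * (1 + |m|) ^ 2 * H ^ 4 := by
        have : 0 ≤ (q : ℝ) ^ 2 * (1 + |m|) ^ 2 * H ^ 4 := by positivity
        linarith

/-- If the circle `(c₁X - c₂)² + (c₁Y - m·c₂)² = c₃` (with `m = p/q`) contains
at least three distinct integer points `(x, y)` with `|x| ≤ H`, `|y| ≤ H`, then
`|c₁| ≤ 4q(1+|m|)H`, `|c₂| ≤ 2qH²` and `c₃ ≤ 36q²(1+|m|)²H⁴`. -/
theorem stmt0 (H : ℝ) (hH : 1 ≤ H) (p q : ℤ) (hq : 0 < q) (m : ℝ) (hm : m = (p : ℝ) / q)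
    (c₁ c₂ c₃ : ℤ) (hc₁ : c₁ ≠ 0) (hc₃ : 0 ≤ c₃)
    (hcop : (c₁ = 1 ∧ c₂ = 0) ∨ (c₂ = 1 ∧ c₁ = 0) ∨ (c₁ ≠ 0 ∧ c₂ ≠ 0 ∧ IsCoprime c₁ c₂))
    (h3 : ∃ S : Finset (ℤ × ℤ), 3 ≤ S.card ∧ ∀ P ∈ S,
      |(P.1 : ℝ)| ≤ H ∧ |(P.2 : ℝ)| ≤ H ∧
      ((c₁ : ℝ) * P.1 - c₂) ^ 2 + ((c₁ : ℝ) * P.2 - m * c₂) ^ 2 = c₃) :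
    |(c₁ : ℝ)| ≤ 4 * q * (1 + |m|) * H ∧ |(c₂ : ℝ)| ≤ 2 * q * H ^ 2 ∧
      (c₃ : ℝ) ≤ 36 * q ^ 2 * (1 + |m|) ^ 2 * H ^ 4 := by
  have hcop' : IsCoprime c₁ c₂ := by
    rcases hcop with ⟨rfl, -⟩ | ⟨rfl, -⟩ | ⟨-, -, h⟩
    exacts [isCoprime_one_left, isCoprime_one_right, h]
  obtain ⟨S, hS, hSP⟩ := h3
  obtain ⟨P, Q, R, hP, hQ, hR, hPQ, hPR, hQR⟩ := Finset.two_lt_card_iff.mp hS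
  have eP := hSP P hP
  have eQ := hSP Q hQ
  have eR := hSP R hR
  by_cases hLQ : (P.1 : ℝ) + m * P.2 = Q.1 + m * Q.2
  swap
  · exact circle_bounds_of_two_points hq hm hc₁ hcop' eP eQ hLQ
  by_cases hLR : (P.1 : ℝ) + m * P.2 = R.1 + m * R.2
  swap
  · exact circle_bounds_of_two_points hq hm hc₁ hcop' eP eR hLR
  have hne : ∀ {A B : ℤ × ℤ}, A ≠ B → ¬((A.1 : ℝ) = B.1 ∧ (A.2 : ℝ) = B.2) :=
    fun hAB h => hAB (Prod.ext (by exact_mod_cast h.1) (by exact_mod_cast h.2))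
  have hc : (c₁ : ℝ) ^ 2 ≠ 0 := pow_ne_zero 2 (by exact_mod_cast hc₁)
  exact (false_of_three_points_on_line_and_circle (hne hPQ) (hne hPR) (hne hQR) hLQ hLR
    (mul_left_cancel₀ hc (by linear_combination eP.2.2 - eQ.2.2 + 2 * c₁ * c₂ * hLQ))
    (mul_left_cancel₀ hc (by linear_combination eP.2.2 - eR.2.2 + 2 * c₁ * c₂ * hLR))).elim
end

section
/- Let I be a real interval of length H, where H ≥ 1 is a real number. For every quadratic polynomial P(T) = a₀T² + a₁T + a₂ with integer coefficients and a₀ ≠ 0, and every integer k, the number of integer points (x, y) in I × I satisfying P(x) + P(y) = k does not exceed sup over integers n with 1 ≤ n ≤ 144H⁴ of r(n). -/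
/-- `r n` is the number of integer points `(x, y)` with `x² + y² = n`. -/
noncomputable def r (n : ℤ) : ℕ := {P : ℤ × ℤ | P.1 ^ 2 + P.2 ^ 2 = n}.ncard

/-- A circle about the origin contains finitely many integer points. -/
lemma finite_sq_add_sq_eq (n : ℤ) : {P : ℤ × ℤ | P.1 ^ 2 + P.2 ^ 2 = n}.Finite := by
  refine ((Set.finite_Icc (-n) n).prod (Set.finite_Icc (-n) n)).subset ?_
  rintro ⟨x, y⟩ h
  have hx := Int.le_self_sq x
  have hx' := Int.le_self_sq (-x)
  have hy := Int.le_self_sq y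
  have hy' := Int.le_self_sq (-y)
  simp only [Set.mem_ofPred_eq, neg_sq] at h hx' hy'
  simp only [Set.mem_prod, Set.mem_Icc]
  refine ⟨⟨?_, ?_⟩, ?_, ?_⟩ <;> linarith [sq_nonneg x, sq_nonneg y]

lemma r_le_sSup {B : ℝ} {n : ℤ} (hn : 1 ≤ n) (hnB : (n : ℝ) ≤ B) :
    r n ≤ sSup {m : ℕ | ∃ n : ℤ, 1 ≤ n ∧ (n : ℝ) ≤ B ∧ m = r n} := by
  refine le_csSup (Set.Finite.bddAbove ?_) ⟨n, hn, hnB, rfl⟩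
  refine ((Set.finite_Icc 1 ⌊B⌋).image r).subset ?_
  rintro _ ⟨j, hj, hjB, rfl⟩
  exact ⟨j, ⟨hj, Int.le_floor.2 hjB⟩, rfl⟩

lemma two_le_r_one : 2 ≤ r 1 := by
  rw [← Set.ncard_pair (a := ((1, 0) : ℤ × ℤ)) (b := (0, 1)) (by decide)]
  refine Set.ncard_le_ncard ?_ (finite_sq_add_sq_eq 1)
  rintro _ (rfl | rfl) <;> simp

/-- If an affine map `(x, y) ↦ (2qx - p, 2qy - p)` with `q ≠ 0` sends a set of integer points into
the circle `X² + Y² = n`, then the set has at most `r n` elements. -/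
lemma ncard_le_r {S : Set (ℤ × ℤ)} {p q n : ℤ} (hq : q ≠ 0)
    (hS : ∀ P ∈ S, (2 * q * P.1 - p) ^ 2 + (2 * q * P.2 - p) ^ 2 = n) : S.ncard ≤ r n := by
  refine Set.ncard_le_ncard_of_injOn (fun P => (2 * q * P.1 - p, 2 * q * P.2 - p))
    hS ?_ (finite_sq_add_sq_eq n)
  rintro ⟨x, y⟩ - ⟨x', y'⟩ - h
  simpa [hq] using h

/-- Integer points with equal coordinate sums and equal sums of squares of coordinates agree up to
swapping the coordinates. -/
lemma eq_or_eq_swap {x y x' y' : ℤ} (h₁ : x + y = x' + y')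
    (h₂ : x ^ 2 + y ^ 2 = x' ^ 2 + y' ^ 2) : (x, y) = (x', y') ∨ (x, y) = (y', x') := by
  have h : (x - x') * (x - y') = 0 := by
    obtain rfl : y = x' + y' - x := by linarith
    linarith
  rcases mul_eq_zero.1 h with h | h
  · left; ext <;> simp <;> linarith
  · right; ext <;> simp <;> linarith

/-- The squared radius of the rescaled circle through two integer points of a square of side `H`
is at most `144 H⁴`. -/
lemma rescaled_radius_le {H α x y z w : ℝ} (hx : x ∈ Set.Icc α (α + H))
    (hy : y ∈ Set.Icc α (α + H)) (hz : z ∈ Set.Icc α (α + H)) (hw : w ∈ Set.Icc α (α + H)) :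
    (2 * (x + y - (z + w)) * x - (x ^ 2 + y ^ 2 - (z ^ 2 + w ^ 2))) ^ 2 +
      (2 * (x + y - (z + w)) * y - (x ^ 2 + y ^ 2 - (z ^ 2 + w ^ 2))) ^ 2 ≤ 144 * H ^ 4 := by
  obtain ⟨hx₁, hx₂⟩ := hx
  obtain ⟨hy₁, hy₂⟩ := hy
  obtain ⟨hz₁, hz₂⟩ := hz
  obtain ⟨hw₁, hw₂⟩ := hw
  have hs : (x + y - (z + w)) ^ 2 ≤ (2 * H) ^ 2 := sq_le_sq' (by linarith) (by linarith)
  have hd : (x - y) ^ 2 ≤ H ^ 2 := sq_le_sq' (by linarith) (by linarith)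
  have hd' : (z - w) ^ 2 ≤ H ^ 2 := sq_le_sq' (by linarith) (by linarith)
  have h₁ : ((x + y - (z + w)) ^ 2 - ((x - y) ^ 2 - (z - w) ^ 2)) ^ 2 ≤ (5 * H ^ 2) ^ 2 :=
    sq_le_sq' (by nlinarith [sq_nonneg (x + y - (z + w)), sq_nonneg (z - w), sq_nonneg H])
      (by nlinarith [sq_nonneg (x - y)])
  have h₂ : (x + y - (z + w)) ^ 2 * (x - y) ^ 2 ≤ (2 * H) ^ 2 * H ^ 2 := by gcongr
  have hH : 0 ≤ H ^ 4 := by positivity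
  linear_combination (1 / 2) * h₁ + 2 * h₂ + (144 - 41 / 2) * hH

/-- If `I` is a real interval of length `H ≥ 1`, `P(T) = a₀T² + a₁T + a₂` is a
quadratic polynomial with integer coefficients (`a₀ ≠ 0`) and `k` is an integer, then the
number of integer points `(x, y) ∈ I × I` with `P(x) + P(y) = k` does not exceed
`sup_{1 ≤ n ≤ 144H⁴} r(n)`. -/
theorem stmt2 (H : ℝ) (hH : 1 ≤ H) (α : ℝ) (a₀ a₁ a₂ : ℤ) (ha₀ : a₀ ≠ 0) (k : ℤ) :
    {P : ℤ × ℤ | (P.1 : ℝ) ∈ Set.Icc α (α + H) ∧ (P.2 : ℝ) ∈ Set.Icc α (α + H) ∧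
        (a₀ * P.1 ^ 2 + a₁ * P.1 + a₂) + (a₀ * P.2 ^ 2 + a₁ * P.2 + a₂) = k}.ncard ≤
      sSup {m : ℕ | ∃ n : ℤ, 1 ≤ n ∧ (n : ℝ) ≤ 144 * H ^ 4 ∧ m = r n} := by
  set S := {P : ℤ × ℤ | (P.1 : ℝ) ∈ Set.Icc α (α + H) ∧ (P.2 : ℝ) ∈ Set.Icc α (α + H) ∧
        (a₀ * P.1 ^ 2 + a₁ * P.1 + a₂) + (a₀ * P.2 ^ 2 + a₁ * P.2 + a₂) = k}
  by_cases hline : ∀ P ∈ S, ∀ Q ∈ S, P.1 + P.2 = Q.1 + Q.2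
  · have hcard : S.ncard ≤ 2 := by
      rcases S.eq_empty_or_nonempty with hE | ⟨⟨x, y⟩, hxy⟩
      · simp [hE]
      · have hsub : S ⊆ {(x, y), (y, x)} := by
          rintro ⟨z, w⟩ hzw
          have hsum := hline _ hzw _ hxy
          refine eq_or_eq_swap hsum (mul_left_cancel₀ ha₀ ?_)
          have h₁ := hxy.2.2
          have h₂ := hzw.2.2
          simp only at h₁ h₂ hsum
          linear_combination h₂ - h₁ - a₁ * hsum
        exact (Set.ncard_le_ncard hsub (Set.toFinite _)).trans
          ((Set.ncard_insert_le _ _).trans (by simp))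
    refine (hcard.trans two_le_r_one).trans (r_le_sSup le_rfl ?_)
    have : 1 ≤ H ^ 4 := one_le_pow₀ hH
    push_cast
    linarith
  · push Not at hline
    obtain ⟨⟨x, y⟩, hxy, ⟨z, w⟩, hzw, hne⟩ := hline
    simp only at hne
    have hq : x + y - (z + w) ≠ 0 := sub_ne_zero.2 hne
    set q := x + y - (z + w) with hqdef
    set p := x ^ 2 + y ^ 2 - (z ^ 2 + w ^ 2) with hpdef
    have hpq : a₀ * p + a₁ * q = 0 := by
      have h₁ := hxy.2.2
      have h₂ := hzw.2.2
      simp only at h₁ h₂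
      linear_combination h₁ - h₂
    have hcircle : ∀ P ∈ S, (2 * q * P.1 - p) ^ 2 + (2 * q * P.2 - p) ^ 2 =
        (2 * q * x - p) ^ 2 + (2 * q * y - p) ^ 2 := by
      rintro ⟨u, v⟩ huv
      have h₁ := hxy.2.2
      have h₂ := huv.2.2
      simp only at h₁ h₂ ⊢
      refine mul_left_cancel₀ ha₀ ?_
      linear_combination 4 * q ^ 2 * (h₂ - h₁) - 4 * q * (u + v - x - y) * hpq
    refine (ncard_le_r hq hcircle).trans (r_le_sSup ?_ ?_)
    · by_contra hlt
      have hz := hcircle _ hzw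
      simp only at hz
      have e₁ : 2 * q * x - p = 0 := by nlinarith [sq_nonneg (2 * q * y - p)]
      have e₂ : 2 * q * y - p = 0 := by nlinarith [sq_nonneg (2 * q * x - p)]
      rw [e₁, e₂] at hz
      have e₃ : 2 * q * z - p = 0 := by nlinarith [sq_nonneg (2 * q * w - p)]
      have e₄ : 2 * q * w - p = 0 := by nlinarith [sq_nonneg (2 * q * z - p)]
      have : 2 * q * q = 0 := by linear_combination 2 * q * hqdef + e₁ + e₂ - e₃ - e₄
      simp [hq] at this
    · rw [hqdef, hpdef]
      push_cast
      exact rescaled_radius_le hxy.1 hxy.2.1 hzw.1 hzw.2.1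
end

section
/- Let δ > 0, let X be a δ-spaced set of real numbers, let ε > 0, and let φ_ε denote the characteristic function of the interval [−ε, ε]. Then ∫_R |Σ_{x∈X} φ_ε(t − x)|² dt ≤ 2ε · Card(X) · (1 + 4ε/δ). -/
open MeasureTheory

/-- A `δ`-spaced finite set contained in `[a, b]` has at most `1 + (b - a) / δ` elements. -/
lemma card_le_of_spaced {δ a b : ℝ} (hδ : 0 < δ) (hab : a ≤ b) (Y : Finset ℝ)
    (hY : ∀ y ∈ Y, y ∈ Set.Icc a b)
    (hsp : ∀ x ∈ Y, ∀ x' ∈ Y, x ≠ x' → δ ≤ |x - x'|) :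
    (Y.card : ℝ) ≤ 1 + (b - a) / δ := by
  have hcard : Y.card ≤ (Finset.range (⌊(b - a) / δ⌋₊ + 1)).card := by
    refine Finset.card_le_card_of_injOn (fun x => ⌊(x - a) / δ⌋₊) ?_ ?_
    · intro x hx
      have hxb := (hY x hx).2
      simp only [Finset.coe_range, Set.mem_Iio, Nat.lt_succ_iff]
      exact Nat.floor_mono (by gcongr)
    · intro x hx y hy hxy
      by_contra hne
      have hx0 : 0 ≤ (x - a) / δ := div_nonneg (sub_nonneg.2 (hY x hx).1) hδ.le
      have hy0 : 0 ≤ (y - a) / δ := div_nonneg (sub_nonneg.2 (hY y hy).1) hδ.le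
      have hxy' : ⌊(x - a) / δ⌋₊ = ⌊(y - a) / δ⌋₊ := hxy
      have hx1 := Nat.floor_le hx0
      have hx2 := Nat.lt_floor_add_one ((x - a) / δ)
      have hy1 := Nat.floor_le hy0
      have hy2 := Nat.lt_floor_add_one ((y - a) / δ)
      rw [hxy'] at hx1 hx2
      have hlt : |(x - a) / δ - (y - a) / δ| < 1 := by
        rw [abs_lt]; constructor <;> linarith
      rw [← sub_div, sub_sub_sub_cancel_right, abs_div, abs_of_pos hδ, div_lt_one hδ] at hlt
      exact absurd (hsp x hx y hy hne) (not_le.2 hlt)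
  rw [Finset.card_range] at hcard
  have hfloor := Nat.floor_le (div_nonneg (sub_nonneg.2 hab) hδ.le)
  have hcard' : (Y.card : ℝ) ≤ (⌊(b - a) / δ⌋₊ : ℝ) + 1 := by exact_mod_cast hcard
  linarith

/-- A point lies within `ε` of at most `1 + 2 * ε / δ` elements of a `δ`-spaced set. -/
lemma sum_indicator_le_of_spaced {δ ε : ℝ} (hδ : 0 < δ) (hε : 0 ≤ ε) (X : Finset ℝ)
    (hsp : ∀ x ∈ X, ∀ x' ∈ X, x ≠ x' → δ ≤ |x - x'|) (t : ℝ) :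
    ∑ x ∈ X, Set.indicator (Set.Icc (-ε) ε) (fun _ => (1 : ℝ)) (t - x) ≤ 1 + 2 * ε / δ := by
  classical
  have hcard := card_le_of_spaced hδ (by linarith : t - ε ≤ t + ε)
    (X.filter fun x => t - x ∈ Set.Icc (-ε) ε)
    (fun y hy => by
      obtain ⟨h1, h2⟩ := (Finset.mem_filter.1 hy).2
      constructor <;> linarith)
    (fun x hx x' hx' => hsp x (Finset.mem_filter.1 hx).1 x' (Finset.mem_filter.1 hx').1)
  simp only [Set.indicator_apply, Finset.sum_boole]
  calc _ ≤ _ := hcard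
    _ = _ := by ring

/-- for a `δ`-spaced set `X` and `φ_ε` the characteristic function of `[-ε, ε]`,
`∫_ℝ |Σ_{x ∈ X} φ_ε(t - x)|² dt ≤ 2ε · Card(X) · (1 + 4ε/δ)`. -/
theorem stmt9 (δ ε : ℝ) (hδ : 0 < δ) (hε : 0 < ε) (X : Finset ℝ) (hX2 : 2 ≤ X.card)
    (hXsp : ∀ x ∈ X, ∀ x' ∈ X, x ≠ x' → δ ≤ |x - x'|) :
    (∫ t : ℝ, |∑ x ∈ X, Set.indicator (Set.Icc (-ε) ε) (fun _ => (1 : ℝ)) (t - x)| ^ 2) ≤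
      2 * ε * (X.card : ℝ) * (1 + 4 * ε / δ) := by
  have hφ : Integrable (Set.indicator (Set.Icc (-ε) ε) (fun _ => (1 : ℝ))) :=
    (integrable_indicator_iff measurableSet_Icc).2
      (integrableOn_const (by simp [Real.volume_Icc]))
  have hφx : ∀ x ∈ X, Integrable fun t : ℝ =>
      Set.indicator (Set.Icc (-ε) ε) (fun _ => (1 : ℝ)) (t - x) :=
    fun x _ => hφ.comp_sub_right x
  have hint : ∫ t : ℝ, Set.indicator (Set.Icc (-ε) ε) (fun _ => (1 : ℝ)) t = 2 * ε := by
    rw [integral_indicator measurableSet_Icc, setIntegral_const, Real.volume_real_Icc_of_le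
      (by linarith), smul_eq_mul]
    ring
  calc _ ≤ ∫ t : ℝ, (1 + 2 * ε / δ) *
        ∑ x ∈ X, Set.indicator (Set.Icc (-ε) ε) (fun _ => (1 : ℝ)) (t - x) := by
        refine integral_mono_of_nonneg (.of_forall fun t => by positivity)
          ((integrable_finsetSum X hφx).const_mul _) (.of_forall fun t => ?_)
        have h0 : 0 ≤ ∑ x ∈ X, Set.indicator (Set.Icc (-ε) ε) (fun _ => (1 : ℝ)) (t - x) :=
          Finset.sum_nonneg fun x _ => Set.indicator_nonneg (fun _ _ => zero_le_one) _
        simp only [abs_of_nonneg h0, sq]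
        exact mul_le_mul_of_nonneg_right (sum_indicator_le_of_spaced hδ hε.le X hXsp t) h0
    _ = 2 * ε * (X.card : ℝ) * (1 + 2 * ε / δ) := by
        rw [integral_const_mul, integral_finsetSum X hφx]
        simp only [integral_sub_right_eq_self
          (Set.indicator (Set.Icc (-ε) ε) (fun _ => (1 : ℝ))), hint, Finset.sum_const,
          nsmul_eq_mul]
        ring
    _ ≤ _ := by gcongr; norm_num
end
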